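/- Let F : X₁ → X₂ and G : X₂ → X₃ be suitable relations between compact metric spaces. Define G • F = π₁₃( closure( {(x,y,z) : (x,y) ∈ F, (y,z) ∈ G and y ∈ ONE_G} ) ), where π₁₃ : X₁ × X₂ × X₃ → X₁ × X₃ is the projection onto the first and third coordinates. Then G • F is a suitable relation from X₁ to X₃, G • F ⊆ G ∘ F, and G • F is the unique closed subset of the composite relation G ∘ F which is minimal for the restriction to G ∘ F of the first-coordinate projection. -/

import Mathlib

open Set Topology

/-- A continuous map is *almost open* if the image of every nonempty open set
has nonempty interior. -/
def AlmostOpen {α β : Type*} [TopologicalSpace α] [TopologicalSpace β] (f : α → β) : Prop :=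
  ∀ U : Set α, IsOpen U → U.Nonempty → (interior (f '' U)).Nonempty

/-- A surjective continuous map is *irreducible* when the only closed subset of its
domain mapping onto the codomain is the whole domain. -/
def IrreducibleMap {α β : Type*} [TopologicalSpace α] [TopologicalSpace β] (f : α → β) : Prop :=
  Function.Surjective f ∧ ∀ A : Set α, IsClosed A → f '' A = Set.univ → A = Set.univ

/-- The restriction to a relation `F ⊆ X₁ × X₂` of the first-coordinate projection. -/
def projOne {X₁ X₂ : Type*} (F : Set (X₁ × X₂)) : F → X₁ := fun p => (p : X₁ × X₂).1

/-- The restriction to a relation `F ⊆ X₁ × X₂` of the second-coordinate projection. -/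
def projTwo {X₁ X₂ : Type*} (F : Set (X₁ × X₂)) : F → X₂ := fun p => (p : X₁ × X₂).2

/-- A *suitable relation* is a closed relation with irreducible first projection and
almost open second projection. -/
def Suitable {X₁ X₂ : Type*} [TopologicalSpace X₁] [TopologicalSpace X₂]
    (F : Set (X₁ × X₂)) : Prop :=
  IsClosed F ∧ IrreducibleMap (projOne F) ∧ AlmostOpen (projTwo F)

/-- `ONE F` is the set of points `x` such that `F(x)` is a singleton. -/
def ONE {X₁ X₂ : Type*} (F : Set (X₁ × X₂)) : Set X₁ := {x | ∃ y, {y' | (x, y') ∈ F} = {y}}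

/-- Composition of relations: `G ∘ F = {(x,z) : ∃ y, (x,y) ∈ F ∧ (y,z) ∈ G}`. -/
def RelComp {X₁ X₂ X₃ : Type*} (G : Set (X₂ × X₃)) (F : Set (X₁ × X₂)) : Set (X₁ × X₃) :=
  {p | ∃ y, (p.1, y) ∈ F ∧ (y, p.2) ∈ G}

/-- Suitable composition `G • F`: the image under the projection `π₁₃` of the closure of
`{(x,y,z) : (x,y) ∈ F, (y,z) ∈ G, y ∈ ONE_G}`. -/
def SuitComp {X₁ X₂ X₃ : Type*} [TopologicalSpace X₁] [TopologicalSpace X₂]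
    [TopologicalSpace X₃] (G : Set (X₂ × X₃)) (F : Set (X₁ × X₂)) : Set (X₁ × X₃) :=
  (fun t : X₁ × X₂ × X₃ => (t.1, t.2.2)) ''
    closure {t : X₁ × X₂ × X₃ | (t.1, t.2.1) ∈ F ∧ (t.2.1, t.2.2) ∈ G ∧ t.2.1 ∈ ONE G}

lemma aux_open {X Y : Type*} [TopologicalSpace X] [TopologicalSpace Y] [CompactSpace Y]
    {F : Set (X × Y)} (hF : IsClosed F) {V : Set (X × Y)} (hV : IsOpen V) :
    IsOpen {x | ∀ y, (x, y) ∈ F → (x, y) ∈ V} := by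
  have h : IsClosed (Prod.fst '' (F ∩ Vᶜ)) :=
    isClosedMap_fst_of_compactSpace _ (hF.inter hV.isClosed_compl)
  have e : {x | ∀ y, (x, y) ∈ F → (x, y) ∈ V} = (Prod.fst '' (F ∩ Vᶜ))ᶜ := by
    ext x
    simp
  rw [e]
  exact h.isOpen_compl

lemma aux_surj {X Y : Type*} [TopologicalSpace X] [TopologicalSpace Y]
    {F : Set (X × Y)} (hF : Suitable F) (x : X) : ∃ y, (x, y) ∈ F := by
  obtain ⟨⟨⟨a, b⟩, hp⟩, h⟩ := hF.2.1.1 x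
  simp only [projOne] at h
  subst h
  exact ⟨b, hp⟩

lemma aux_irr {X Y : Type*} [TopologicalSpace X] [TopologicalSpace Y] [CompactSpace Y]
    {F : Set (X × Y)} (hF : Suitable F) {x : X} {y : Y} (h : (x, y) ∈ F)
    {O : Set X} {V : Set Y} (hO : IsOpen O) (hV : IsOpen V) (hx : x ∈ O) (hy : y ∈ V) :
    ∃ O' : Set X, IsOpen O' ∧ O'.Nonempty ∧ O' ⊆ O ∧ ∀ a b, (a, b) ∈ F → a ∈ O' → b ∈ V := by
  refine ⟨{x | ∀ y, (x, y) ∈ F → (x, y) ∈ O ×ˢ V}, aux_open hF.1 (hO.prod hV), ?_, ?_, ?_⟩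
  · by_contra hne
    have := hF.2.1.2 {p : F | (p : X × Y) ∉ O ×ˢ V}
      ((hO.prod hV).isClosed_compl.preimage continuous_subtype_val) (by
        refine eq_univ_of_forall fun a => ?_
        have ha : ¬ ∀ y, (a, y) ∈ F → (a, y) ∈ O ×ˢ V := fun h' => hne ⟨a, h'⟩
        push Not at ha
        obtain ⟨b, hb, hb'⟩ := ha
        exact ⟨⟨(a, b), hb⟩, hb', rfl⟩)
    have h2 : (⟨(x, y), h⟩ : F) ∈ {p : F | (p : X × Y) ∉ O ×ˢ V} := by
      rw [this]; trivial
    exact h2 ⟨hx, hy⟩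
  · intro a ha
    obtain ⟨b, hb⟩ := aux_surj hF a
    exact (ha b hb).1
  · intro a b hab ha
    exact (ha b hab).2

lemma aux_ao {X Y : Type*} [TopologicalSpace X] [TopologicalSpace Y]
    {F : Set (X × Y)} (hF : Suitable F) {x : X} {y : Y} (h : (x, y) ∈ F)
    {O : Set X} {V : Set Y} (hO : IsOpen O) (hV : IsOpen V) (hx : x ∈ O) (hy : y ∈ V) :
    ∃ W : Set Y, IsOpen W ∧ W.Nonempty ∧ ∀ w ∈ W, w ∈ V ∧ ∃ a ∈ O, (a, w) ∈ F := by
  refine ⟨_, isOpen_interior, hF.2.2 {p : F | (p : X × Y) ∈ O ×ˢ V}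
    ((hO.prod hV).preimage continuous_subtype_val) ⟨⟨(x, y), h⟩, hx, hy⟩, ?_⟩
  intro w hw
  obtain ⟨⟨⟨a, b⟩, hp⟩, hq, rfl⟩ := interior_subset hw
  exact ⟨hq.2, a, hq.1, hp⟩

lemma aux_ONE {X Y : Type*} [MetricSpace X] [MetricSpace Y] [CompactSpace Y]
    {F : Set (X × Y)} (hF : Suitable F) : ONE F ∈ residual X := by
  have key : ∀ n : ℕ, (⋃ c : Y, {x | ∀ y, (x, y) ∈ F →
      (x, y) ∈ (univ : Set X) ×ˢ Metric.ball c (1 / ((n : ℝ) + 1))}) ∈ residual X := by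
    intro n
    have hn : (0 : ℝ) < 1 / ((n : ℝ) + 1) := by positivity
    refine residual_of_dense_open
      (isOpen_iUnion fun c => aux_open hF.1 (isOpen_univ.prod Metric.isOpen_ball)) ?_
    rw [dense_iff_inter_open]
    rintro O hO ⟨x, hx⟩
    obtain ⟨y, hy⟩ := aux_surj hF x
    obtain ⟨O', -, ⟨a, ha⟩, hsub, hO'⟩ := aux_irr hF hy hO Metric.isOpen_ball hx
      (Metric.mem_ball_self hn)
    exact ⟨a, hsub ha, mem_iUnion.2 ⟨y, fun b hb => ⟨trivial, hO' a b hb ha⟩⟩⟩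
  refine Filter.mem_of_superset (countable_iInter_mem.2 key) ?_
  intro x hx
  obtain ⟨y, hy⟩ := aux_surj hF x
  refine ⟨y, Subset.antisymm ?_ (by rintro _ rfl; exact hy)⟩
  intro y' hy'
  rw [mem_singleton_iff]
  by_contra hne
  have hd : 0 < dist y' y / 2 := half_pos (dist_pos.2 hne)
  obtain ⟨n, hn⟩ := exists_nat_one_div_lt hd
  obtain ⟨c, hc⟩ := mem_iUnion.1 (mem_iInter.1 hx n)
  have h1 := Metric.mem_ball.1 (hc y hy).2
  have h2 := Metric.mem_ball.1 (hc y' hy').2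
  have h3 := dist_triangle_right y' y c
  simp only at h1 h2
  linarith

lemma aux_pull {X Y : Type*} [MetricSpace X] [MetricSpace Y] [CompactSpace Y]
    {F : Set (X × Y)} (hF : Suitable F) {S : Set Y} (hS : S ∈ residual Y) :
    {x | ∀ y, (x, y) ∈ F → y ∈ S} ∈ residual X := by
  obtain ⟨T, hTo, hTd, hTc, hTS⟩ := mem_residual_iff.1 hS
  have : (⋂ t ∈ T, {x | ∀ y, (x, y) ∈ F → (x, y) ∈ (univ : Set X) ×ˢ t}) ∈ residual X := by
    refine (countable_bInter_mem hTc).2 fun t ht => ?_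
    refine residual_of_dense_open (aux_open hF.1 (isOpen_univ.prod (hTo t ht))) ?_
    rw [dense_iff_inter_open]
    rintro O hO ⟨x, hx⟩
    obtain ⟨y, hy⟩ := aux_surj hF x
    obtain ⟨W, hW, hWn, hW'⟩ := aux_ao hF hy hO isOpen_univ hx trivial
    obtain ⟨w, hw, hwt⟩ := (hTd t ht).inter_open_nonempty W hW hWn
    obtain ⟨-, a, ha, haw⟩ := hW' w hw
    obtain ⟨O', -, ⟨a, ha⟩, hsub, hO'⟩ := aux_irr hF haw hO (hTo t ht) ha hwt
    exact ⟨a, hsub ha, fun b hb => ⟨trivial, hO' a b hb ha⟩⟩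
  refine Filter.mem_of_superset this ?_
  intro x hx y hy
  refine hTS fun t ht => ?_
  exact ((mem_iInter₂.1 hx t ht) y hy).2

theorem stmt17 {X₁ X₂ X₃ : Type*} [MetricSpace X₁] [MetricSpace X₂] [MetricSpace X₃]
    [CompactSpace X₁] [CompactSpace X₂] [CompactSpace X₃]
    (F : Set (X₁ × X₂)) (G : Set (X₂ × X₃)) (hF : Suitable F) (hG : Suitable G) :
    Suitable (SuitComp G F) ∧
    SuitComp G F ⊆ RelComp G F ∧
    -- G • F is the unique closed subset of G ∘ F minimal for the first projection
    ((IsClosed (SuitComp G F) ∧ (∀ x : X₁, ∃ z, (x, z) ∈ SuitComp G F) ∧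
        ∀ B ⊆ SuitComp G F, IsClosed B → (∀ x : X₁, ∃ z, (x, z) ∈ B) → B = SuitComp G F) ∧
      ∀ A ⊆ RelComp G F, IsClosed A → (∀ x : X₁, ∃ z, (x, z) ∈ A) →
        (∀ B ⊆ A, IsClosed B → (∀ x : X₁, ∃ z, (x, z) ∈ B) → B = A) →
        A = SuitComp G F) := by
  have hcont : Continuous (fun t : X₁ × X₂ × X₃ => (t.1, t.2.2)) := by fun_prop
  set D := {t : X₁ × X₂ × X₃ | (t.1, t.2.1) ∈ F ∧ (t.2.1, t.2.2) ∈ G ∧ t.2.1 ∈ ONE G} with hD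
  have hSC : SuitComp G F = (fun t : X₁ × X₂ × X₃ => (t.1, t.2.2)) '' closure D := rfl
  have hclosed : IsClosed (SuitComp G F) := by
    rw [hSC]
    exact (isClosed_closure.isCompact.image hcont).isClosed
  have hDmem : ∀ x y z, (x, y) ∈ F → (y, z) ∈ G → y ∈ ONE G → (x, z) ∈ SuitComp G F :=
    fun x y z h1 h2 h3 => ⟨(x, y, z), subset_closure ⟨h1, h2, h3⟩, rfl⟩
  have hsub : SuitComp G F ⊆ RelComp G F := by
    rintro _ ⟨⟨x, y, z⟩, ht, rfl⟩
    have hc : IsClosed {t : X₁ × X₂ × X₃ | (t.1, t.2.1) ∈ F ∧ (t.2.1, t.2.2) ∈ G} :=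
      (hF.1.preimage (f := fun t : X₁ × X₂ × X₃ => (t.1, t.2.1)) (by fun_prop)).inter
        (hG.1.preimage (f := fun t : X₁ × X₂ × X₃ => (t.2.1, t.2.2)) (by fun_prop))
    have hDs : D ⊆ {t : X₁ × X₂ × X₃ | (t.1, t.2.1) ∈ F ∧ (t.2.1, t.2.2) ∈ G} := fun t ht => ⟨ht.1, ht.2.1⟩
    have hmem := closure_minimal hDs hc ht
    exact ⟨y, hmem.1, hmem.2⟩
  have hONE : Dense (ONE G) := dense_of_mem_residual (aux_ONE hG)
  have hR : Dense (ONE F ∩ {x | ∀ y, (x, y) ∈ F → y ∈ ONE G}) :=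
    dense_of_mem_residual (Filter.inter_mem (aux_ONE hF) (aux_pull hF (aux_ONE hG)))
  set R := ONE F ∩ {x | ∀ y, (x, y) ∈ F → y ∈ ONE G} with hRdef
  -- on R the composite is single valued
  have hsing : ∀ x ∈ R, ∀ z z', (x, z) ∈ RelComp G F → (x, z') ∈ RelComp G F → z = z' := by
    rintro x ⟨⟨y₀, hy₀⟩, hx⟩ z z' ⟨y, hy, hz⟩ ⟨y', hy', hz'⟩
    have e1 : y = y₀ := by
      have : y ∈ {y' | (x, y') ∈ F} := hy
      rwa [hy₀] at this
    have e2 : y' = y₀ := by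
      have : y' ∈ {y' | (x, y') ∈ F} := hy'
      rwa [hy₀] at this
    subst e1 e2
    obtain ⟨z₀, hz₀⟩ := hx _ hy
    have e3 : z ∈ {z | (y', z) ∈ G} := hz
    have e4 : z' ∈ {z | (y', z) ∈ G} := hz'
    rw [hz₀] at e3 e4
    rw [mem_singleton_iff] at e3 e4
    rw [e3, e4]
  -- continuity of G at points of ONE G
  have hcts : ∀ y ∈ ONE G, ∀ z, (y, z) ∈ G → ∀ W : Set X₃, IsOpen W → z ∈ W →
      ∃ V : Set X₂, IsOpen V ∧ y ∈ V ∧ ∀ a b, (a, b) ∈ G → a ∈ V → b ∈ W := by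
    rintro y ⟨z₀, hz₀⟩ z hz W hW hzW
    refine ⟨_, aux_open hG.1 (isOpen_univ.prod hW), ?_, fun a b hab ha => (ha b hab).2⟩
    intro b hb
    have e3 : z ∈ {z | (y, z) ∈ G} := hz
    have e4 : b ∈ {z | (y, z) ∈ G} := hb
    rw [hz₀] at e3 e4
    rw [mem_singleton_iff] at e3 e4
    refine ⟨trivial, ?_⟩
    simp only
    rw [e4, ← e3]
    exact hzW
  -- any closed surjective subset of the composite contains the suitable composite
  have hmin : ∀ A ⊆ RelComp G F, IsClosed A → (∀ x : X₁, ∃ z, (x, z) ∈ A) →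
      SuitComp G F ⊆ A := by
    intro A hA hAc hAs
    rw [hSC, image_subset_iff]
    refine closure_minimal ?_ (hAc.preimage hcont)
    rintro ⟨x, y, z⟩ ⟨hxy, hyz, hy⟩
    change (x, z) ∈ A
    simp only at hxy hyz hy
    rw [← hAc.closure_eq, mem_closure_iff]
    intro N hN hxz
    obtain ⟨O, W, hO, hW, hxO, hzW, hOW⟩ := isOpen_prod_iff.1 hN x z hxz
    obtain ⟨V, hV, hyV, hVW⟩ := hcts y hy z hyz W hW hzW
    obtain ⟨O', hO', hne, hO'O, hFO'⟩ := aux_irr hF hxy hO hV hxO hyV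
    obtain ⟨a, ha, haR⟩ := hR.inter_open_nonempty O' hO' hne
    obtain ⟨c, hc⟩ := hAs a
    obtain ⟨b, hab, hbc⟩ := hA hc
    exact ⟨(a, c), hOW ⟨hO'O ha, hVW b c hbc (hFO' a b hab ha)⟩, hc⟩
  have hsurj : ∀ x : X₁, ∃ z, (x, z) ∈ SuitComp G F := by
    have hc : IsClosed (Prod.fst '' SuitComp G F) := (hclosed.isCompact.image continuous_fst).isClosed
    have hRs : R ⊆ Prod.fst '' SuitComp G F := by
      intro x hx
      obtain ⟨y, hy⟩ := aux_surj hF x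
      obtain ⟨z, hz⟩ := aux_surj hG y
      exact ⟨(x, z), hDmem x y z hy hz (hx.2 y hy), rfl⟩
    intro x
    obtain ⟨⟨a, z⟩, h, rfl⟩ := closure_minimal hRs hc (hR x)
    exact ⟨z, h⟩
  have hminB : ∀ B ⊆ SuitComp G F, IsClosed B → (∀ x : X₁, ∃ z, (x, z) ∈ B) →
      B = SuitComp G F := fun B hB hBc hBs =>
    Subset.antisymm hB (hmin B (hB.trans hsub) hBc hBs)
  refine ⟨⟨hclosed, ⟨?_, ?_⟩, ?_⟩, hsub, ⟨hclosed, hsurj, hminB⟩, ?_⟩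
  · intro x
    obtain ⟨z, hz⟩ := hsurj x
    exact ⟨⟨(x, z), hz⟩, rfl⟩
  · intro A hA hAu
    have hB := hminB (Subtype.val '' A) (by rintro _ ⟨p, -, rfl⟩; exact p.2)
      (hclosed.isClosedEmbedding_subtypeVal.isClosedMap _ hA) (by
        intro x
        have : x ∈ projOne (SuitComp G F) '' A := by rw [hAu]; trivial
        obtain ⟨p, hp, rfl⟩ := this
        exact ⟨_, p, hp, rfl⟩)
    refine eq_univ_of_forall fun p => ?_
    have : (p : X₁ × X₃) ∈ Subtype.val '' A := by rw [hB]; exact p.2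
    obtain ⟨q, hq, e⟩ := this
    rwa [← Subtype.ext e]
  · rintro U hU ⟨⟨p, hp⟩, hpU⟩
    obtain ⟨N, hN, rfl⟩ := isOpen_induced_iff.1 hU
    obtain ⟨⟨x₀, y₀, z₀⟩, ht, rfl⟩ := hp
    obtain ⟨O, W, hO, hW, hxO, hzW, hOW⟩ := isOpen_prod_iff.1 hN x₀ z₀ hpU
    obtain ⟨K, hK, hKc, hKO⟩ := exists_mem_nhds_isClosed_subset (hO.mem_nhds hxO)
    obtain ⟨⟨x, y, z⟩, ⟨hx, -, hz⟩, hxy, hyz, hy⟩ := mem_closure_iff.1 ht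
      (interior K ×ˢ (univ ×ˢ W)) (isOpen_interior.prod (isOpen_univ.prod hW))
      ⟨mem_interior_iff_mem_nhds.2 hK, trivial, hzW⟩
    simp only at hx hz hxy hyz hy
    obtain ⟨V, hV, hyV, hVW⟩ := hcts y hy z hyz W hW hz
    obtain ⟨V', hV', ⟨v, hv⟩, hV'p⟩ := aux_ao hF hxy isOpen_interior hV hx hyV
    obtain ⟨w, hvw⟩ := aux_surj hG v
    obtain ⟨W', hW', hW'n, hW'p⟩ := aux_ao hG hvw hV' isOpen_univ hv trivial
    have hPc : IsClosed (Prod.snd '' (SuitComp G F ∩ (Prod.fst ⁻¹' K))) :=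
      ((hclosed.inter (hKc.preimage continuous_fst)).isCompact.image continuous_snd).isClosed
    refine hW'n.mono (interior_maximal ?_ hW')
    intro c hc
    have hcP : c ∈ Prod.snd '' (SuitComp G F ∩ (Prod.fst ⁻¹' K)) := by
      rw [← hPc.closure_eq, mem_closure_iff]
      intro N' hN' hcN'
      obtain ⟨-, b, hb, hbc⟩ := hW'p c hc
      obtain ⟨V'', hV'', hne, hsubV, hV''p⟩ := aux_irr hG hbc hV' hN' hb hcN'
      obtain ⟨b', hb', hb'1⟩ := hONE.inter_open_nonempty V'' hV'' hne
      obtain ⟨c', hc'⟩ := aux_surj hG b'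
      obtain ⟨-, a, ha, hab⟩ := hV'p b' (hsubV hb')
      exact ⟨c', hV''p b' c' hc' hb', (a, c'), ⟨hDmem a b' c' hab hc' hb'1, (interior_subset ha : a ∈ K)⟩, rfl⟩
    obtain ⟨⟨a, c⟩, ⟨hac, haK⟩, rfl⟩ := hcP
    obtain ⟨-, b, hb, hbc⟩ := hW'p _ hc
    exact ⟨⟨(a, c), hac⟩, hOW ⟨hKO haK, hVW b c hbc (hV'p b hb).1⟩, rfl⟩
  · intro A hA hAc hAs hAm
    exact (hAm _ (hmin A hA hAc hAs) hclosed hsurj).symm
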